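/- arXiv:1607.01686 — 2 statements merged into one kernel-verified Lean document; each statement's English description precedes it below -/
import Mathlib

section
/- The problem EQUAL-NEXT for primitive recursive functions is Σ1-complete, in the following uniform sense: (i) for every primitive recursive family F, the set {n : ℕ | ∃ y, F n y = F n (y+1)} is Σ1; and (ii) there exists a primitive recursive family F such that the set {n : ℕ | ∃ y, F n y = F n (y+1)} is Σ1-complete, i.e. every Σ1 subset of ℕ many-one reduces to it. -/
def Sigma1Complete (Q : ℕ → Prop) : Prop :=
  REPred Q ∧ ∀ P : ℕ → Prop, REPred P → ManyOneReducible P Q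

open Nat.Partrec (Code)

/-- The set of instances of EQUAL-NEXT for a primitive recursive family is recursively
enumerable, by unbounded search. -/
theorem rePred_equalNext {F : ℕ → ℕ → ℕ} (hF : Primrec₂ F) :
    REPred fun n => ∃ y, F n y = F n (y + 1) := by
  have hdec : Primrec₂ fun n y => decide (F n y = F n (y + 1)) :=
    (Primrec.eq (α := ℕ)).decide.comp hF
      (hF.comp Primrec.fst (Primrec.succ.comp Primrec.snd))
  have hsearch := (Partrec.rfind hdec.to_comp.partrec₂).dom_re
  refine hsearch.of_eq fun n => ?_
  simp [Nat.rfind_dom]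

/-- The family which at index `⟨c, x⟩` takes pairwise distinct nonzero values as long as the
program `c` is still running on input `x`, and is zero once it has halted. -/
def haltingFamily (n y : ℕ) : ℕ :=
  bif (Code.evaln y (Denumerable.ofNat Code n.unpair.1) n.unpair.2).isSome then 0 else y + 1

theorem primrec₂_haltingFamily : Primrec₂ haltingFamily := by
  have hcode : Primrec fun p : ℕ × ℕ => Denumerable.ofNat Code p.1.unpair.1 :=
    (Primrec.ofNat Code).comp (Primrec.fst.comp (Primrec.unpair.comp Primrec.fst))
  have hinput : Primrec fun p : ℕ × ℕ => p.1.unpair.2 :=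
    Primrec.snd.comp (Primrec.unpair.comp Primrec.fst)
  exact Primrec.cond
    (Primrec.option_isSome.comp
      (Code.primrec_evaln.comp ((Primrec.snd.pair hcode).pair hinput)))
    (Primrec.const 0) (Primrec.succ.comp Primrec.snd)

theorem haltingFamily_equalNext_iff (c : Code) (x : ℕ) :
    (∃ y, haltingFamily (Nat.pair (Encodable.encode c) x) y =
      haltingFamily (Nat.pair (Encodable.encode c) x) (y + 1)) ↔ (c.eval x).Dom := by
  simp only [haltingFamily, Nat.unpair_pair, Denumerable.ofNat_encode]
  constructor
  · rintro ⟨y, hy⟩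
    cases h : Code.evaln y c x with
    | some v => exact Part.dom_iff_mem.2 ⟨v, Code.evaln_sound h⟩
    | none => cases h' : Code.evaln (y + 1) c x <;> simp [h, h'] at hy
  · intro h
    obtain ⟨v, hv⟩ := Part.dom_iff_mem.1 h
    obtain ⟨k, hk⟩ := Code.evaln_complete.1 hv
    have hk' := Code.evaln_mono k.le_succ hk
    rw [Option.mem_def] at hk hk'
    exact ⟨k, by simp [hk, hk']⟩

theorem manyOneReducible_haltingFamily {P : ℕ → Prop} (hP : REPred P) :
    ManyOneReducible P fun n => ∃ y, haltingFamily n y = haltingFamily n (y + 1) := by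
  obtain ⟨c, hc⟩ := Code.exists_code.1
    (Partrec.nat_iff.1 (hP.map (Computable.const 0).to₂))
  refine ⟨fun x => Nat.pair (Encodable.encode c) x,
    (Primrec₂.natPair.comp (Primrec.const _) Primrec.id).to_comp, fun x => ?_⟩
  refine Iff.trans ?_ (haltingFamily_equalNext_iff c x).symm
  simp [hc, Part.assert]

theorem equalNext_Sigma1_complete :
    (∀ F : ℕ → ℕ → ℕ, Primrec₂ F → REPred fun n => ∃ y, F n y = F n (y + 1)) ∧
    (∃ F : ℕ → ℕ → ℕ, Primrec₂ F ∧
      Sigma1Complete fun n => ∃ y, F n y = F n (y + 1)) :=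
  ⟨fun _ hF => rePred_equalNext hF, haltingFamily, primrec₂_haltingFamily,
    rePred_equalNext primrec₂_haltingFamily, fun _ hP => manyOneReducible_haltingFamily hP⟩
end

section
/- The problem EQUAL-AT-ONE-POINT for pairs of primitive recursive functions is Σ1-complete, in the following uniform sense: (i) for every pair of primitive recursive families F and G, the set {n : ℕ | ∃ y, F n y = G n y} is Σ1; and (ii) there exist primitive recursive families F and G such that the set {n : ℕ | ∃ y, F n y = G n y} is Σ1-complete, i.e. every Σ1 subset of ℕ many-one reduces to it. -/
open Nat.Partrec (Code)

theorem REPred.exists_eq_of_primrec₂ {F G : ℕ → ℕ → ℕ} (hF : Primrec₂ F) (hG : Primrec₂ G) :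
    REPred fun n => ∃ y, F n y = G n y := by
  have hdec : Primrec₂ fun n y => decide (F n y = G n y) :=
    (Primrec.eq (α := ℕ)).decide.comp₂ hF hG
  refine (Partrec.rfind hdec.to_comp.partrec₂).dom_re.of_eq fun n => ?_
  simp [Nat.rfind_dom]

theorem REPred.exists_code {P : ℕ → Prop} (hP : REPred P) :
    ∃ c : Code, ∀ n, P n ↔ (c.eval n).Dom := by
  have hpart : Partrec fun n => (Part.assert (P n) fun _ => Part.some ()).map fun _ => (0 : ℕ) :=
    Partrec.map hP (Computable.const 0).to₂
  obtain ⟨c, hc⟩ := Code.exists_code.1 (Partrec.nat_iff.1 hpart)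
  exact ⟨c, fun n => by simp [hc, Part.assert]⟩

/-- Vanishes at `y` exactly when the program coded by `n.unpair.1` halts on input `n.unpair.2`
within `y` steps. -/
def runningIndicator (n y : ℕ) : ℕ :=
  1 - Encodable.encode (Code.evaln y (Denumerable.ofNat Code n.unpair.1) n.unpair.2)

theorem primrec₂_runningIndicator : Primrec₂ runningIndicator := by
  have hunpair : Primrec fun p : ℕ × ℕ => p.1.unpair := Primrec.unpair.comp Primrec.fst
  have hcode : Primrec fun p : ℕ × ℕ => Denumerable.ofNat Code p.1.unpair.1 :=
    (Primrec.ofNat Code).comp (Primrec.fst.comp hunpair)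
  have heval := Code.primrec_evaln.comp
    ((Primrec.snd.pair hcode).pair (Primrec.snd.comp hunpair))
  exact Primrec.nat_sub.comp (Primrec.const 1) (Primrec.encode.comp heval)

theorem exists_runningIndicator_eq_zero_iff (c : Code) (n : ℕ) :
    (∃ y, runningIndicator (Nat.pair (Encodable.encode c) n) y = 0) ↔ (c.eval n).Dom := by
  have hzero (o : Option ℕ) : 1 - Encodable.encode o = 0 ↔ ∃ x, x ∈ o := by
    cases o <;> simp
  simp only [runningIndicator, Nat.unpair_pair, Denumerable.ofNat_encode, hzero, Part.dom_iff_mem,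
    Code.evaln_complete]
  exact exists_comm

theorem equalAtOnePoint_Sigma1_complete :
    (∀ F G : ℕ → ℕ → ℕ, Primrec₂ F → Primrec₂ G →
      REPred fun n => ∃ y, F n y = G n y) ∧
    (∃ F G : ℕ → ℕ → ℕ, Primrec₂ F ∧ Primrec₂ G ∧
      Sigma1Complete fun n => ∃ y, F n y = G n y) := by
  have hzero : Primrec₂ fun _ _ : ℕ => (0 : ℕ) := Primrec₂.const 0
  refine ⟨fun F G hF hG => REPred.exists_eq_of_primrec₂ hF hG,
    runningIndicator, fun _ _ => 0, primrec₂_runningIndicator, hzero,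
    REPred.exists_eq_of_primrec₂ primrec₂_runningIndicator hzero, fun P hP => ?_⟩
  obtain ⟨c, hc⟩ := hP.exists_code
  refine ⟨fun n => Nat.pair (Encodable.encode c) n,
    (Primrec₂.natPair.comp (Primrec.const _) Primrec.id).to_comp, fun n => ?_⟩
  exact (hc n).trans (exists_runningIndicator_eq_zero_iff c n).symm
end
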